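/- arXiv:1611.08006 — 2 statements merged into one kernel-verified Lean document; each statement's English description precedes it below -/
import Mathlib

section
/- (Lemma 1) Let N ≥ 2 and let p_i^min, p_i^max ∈ ℝ for i = 1, …, N satisfy Assumption 2, i.e., p_i^min < min_{1 ≤ j ≤ N} (p_j^max − p_j^min) for every i. Let 2 ≤ k ≤ N and let p ∈ ℝ. If 0 < p − ∑_{i=1}^{k−1} p_i^max < p_k^min, then p_{k−1}^min < p − ∑_{i=1}^{k−2} p_i^max − p_k^min < p_{k−1}^max. -/
/-- Lemma 1: Under Assumption 2 (`pminᵢ < min_j (pmaxⱼ − pminⱼ)` for all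
`i = 1,…,N`), if `0 < p − ∑_{i=1}^{k−1} pmaxᵢ < pmin k` for some `2 ≤ k ≤ N`, then
`pmin (k−1) < p − ∑_{i=1}^{k−2} pmaxᵢ − pmin k < pmax (k−1)`. -/
theorem lemma_one (N : ℕ) (hN : 2 ≤ N) (pmin pmax : ℕ → ℝ)
    (hA2 : ∀ i, 1 ≤ i → i ≤ N → ∀ j, 1 ≤ j → j ≤ N → pmin i < pmax j - pmin j)
    (k : ℕ) (hk1 : 2 ≤ k) (hk2 : k ≤ N) (p : ℝ)
    (h1 : 0 < p - ∑ i ∈ Finset.Icc 1 (k - 1), pmax i)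
    (h2 : p - ∑ i ∈ Finset.Icc 1 (k - 1), pmax i < pmin k) :
    pmin (k - 1) < p - ∑ i ∈ Finset.Icc 1 (k - 2), pmax i - pmin k ∧
    p - ∑ i ∈ Finset.Icc 1 (k - 2), pmax i - pmin k < pmax (k - 1) := by
  obtain ⟨m, rfl⟩ := Nat.exists_eq_add_of_le' hk1
  have hA := hA2 (m + 2) (by omega) hk2 (m + 1) (by omega) (by omega)
  simp only [Nat.add_sub_cancel, show m + 2 - 1 = m + 1 from rfl] at h1 h2 ⊢
  rw [Finset.sum_Icc_succ_top (by omega)] at h1 h2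
  constructor <;> linarith
end

section
/- (KKT verification, marginal-generator case) Let N ≥ 1, r₁ ≥ 0, C ∈ ℝ, and let 0 < π₁ < π₂ < … < π_N be the generators' asking prices. Let p_i^max > 0 for i = 1,…,N, take p_i^min = 0 for all i, and let 1 ≤ k ≤ N. Let p ∈ ℝ satisfy r₁·p² − p + C = 0 and 1 − 2·r₁·p > 0, and assume 0 ≤ p − ∑_{i=1}^{k−1} p_i^max ≤ p_k^max. Define the dispatch p_i := p_i^max for i < k, p_k := p − ∑_{i=1}^{k−1} p_i^max, p_i := 0 for i > k; the price λ := π_k / (1 − 2·r₁·p); and the multipliers μ_i := π_k − π_i, μ̃_i := 0 for i < k; μ_k := μ̃_k := 0; μ_i := 0, μ̃_i := π_i − π_k for i > k. Then this primal-dual point satisfies all KKT conditions of the ISO problem: (i) stationarity: π_i + 2·λ·r₁·∑_{j=1}^N p_j − λ + μ_i − μ̃_i = 0 for every i; (ii) primal feasibility: r₁·(∑_{j=1}^N p_j)² + C = ∑_{j=1}^N p_j and 0 ≤ p_i ≤ p_i^max for every i; (iii) complementary slackness: μ_i·(p_i − p_i^max) = 0 and μ̃_i·(0 − p_i) = 0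 for every i; (iv) dual feasibility: μ_i ≥ 0 and μ̃_i ≥ 0 for every i. -/
/-- KKT verification, marginal-generator case: with asking prices
`0 < π₁ < … < π_N`, `pᵢ^min = 0`, `p` solving `r₁·p² − p + C = 0` with `1 − 2·r₁·p > 0`,
and `0 ≤ p − ∑_{i<k} pᵢ^max ≤ p_k^max`, the dispatch `pdᵢ = pᵢ^max` for `i < k`,
`pd_k = p − ∑_{i<k} pᵢ^max`, `pdᵢ = 0` for `i > k`, the price `λ = π_k/(1 − 2·r₁·p)`, and
the multipliers `μᵢ = π_k − πᵢ`, `μ̃ᵢ = 0` for `i < k`; `μ_k = μ̃_k = 0`; `μᵢ = 0`,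
`μ̃ᵢ = πᵢ − π_k` for `i > k` satisfy all KKT conditions of the ISO problem. -/
theorem kkt_verification (N : ℕ) (hN : 1 ≤ N) (r₁ : ℝ) (hr : 0 ≤ r₁) (C : ℝ)
    (π : Fin N → ℝ) (hπpos : ∀ i, 0 < π i) (hπmono : StrictMono π)
    (pmax : Fin N → ℝ) (hpmax : ∀ i, 0 < pmax i)
    (k : Fin N) (p : ℝ)
    (hbal : r₁ * p ^ 2 - p + C = 0) (hden : 0 < 1 - 2 * r₁ * p)
    (hlo : 0 ≤ p - ∑ i ∈ Finset.univ.filter (· < k), pmax i)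
    (hhi : p - ∑ i ∈ Finset.univ.filter (· < k), pmax i ≤ pmax k)
    (pd : Fin N → ℝ)
    (hpd : ∀ i, pd i =
      if i < k then pmax i
      else if i = k then p - ∑ j ∈ Finset.univ.filter (· < k), pmax j
      else 0)
    (lam : ℝ) (hlam : lam = π k / (1 - 2 * r₁ * p))
    (μ μt : Fin N → ℝ)
    (hμ : ∀ i, μ i = if i < k then π k - π i else 0)
    (hμt : ∀ i, μt i = if k < i then π i - π k else 0) :
    -- (i) stationarity
    (∀ i, π i + 2 * lam * r₁ * (∑ j, pd j) - lam + μ i - μt i = 0) ∧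
    -- (ii) primal feasibility
    (r₁ * (∑ j, pd j) ^ 2 + C = ∑ j, pd j) ∧
    (∀ i, 0 ≤ pd i ∧ pd i ≤ pmax i) ∧
    -- (iii) complementary slackness
    (∀ i, μ i * (pd i - pmax i) = 0 ∧ μt i * (0 - pd i) = 0) ∧
    -- (iv) dual feasibility
    (∀ i, 0 ≤ μ i ∧ 0 ≤ μt i) := by
  have hsum : ∑ j, pd j = p := by
    set S := ∑ j ∈ Finset.univ.filter (· < k), pmax j with hS
    have hsplit : ∀ j, pd j = (if j < k then pmax j else 0) + (if j = k then p - S else 0) := by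
      intro j
      rw [hpd j]
      rcases lt_trichotomy j k with h | h | h
      · simp [h, h.ne]
      · simp [h]
      · simp [h.not_gt, h.ne']
    rw [Finset.sum_congr rfl fun j _ => hsplit j, Finset.sum_add_distrib,
      ← Finset.sum_filter, ← hS]
    simp
  have hprice : lam * (1 - 2 * r₁ * p) = π k := by
    rw [hlam, div_mul_cancel₀ _ hden.ne']
  rw [hsum]
  refine ⟨fun i => ?_, by linarith, fun i => ?_, fun i => ?_, fun i => ?_⟩
  · rw [hμ, hμt]
    rcases lt_trichotomy i k with h | h | h
    · simp only [h, h.not_gt, if_true, if_false]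
      linear_combination -hprice
    · subst h
      simp only [lt_irrefl, if_false]
      linear_combination -hprice
    · simp only [h, h.not_gt, if_true, if_false]
      linear_combination -hprice
  · rw [hpd]
    rcases lt_trichotomy i k with h | h | h
    · simpa [h] using (hpmax i).le
    · subst h
      simpa only [lt_irrefl, if_false, if_true] using ⟨hlo, hhi⟩
    · simpa [h.not_gt, h.ne'] using (hpmax i).le
  · rw [hμ, hμt, hpd]
    rcases lt_trichotomy i k with h | h | h
    · simp [h, h.not_gt]
    · simp [h]
    · simp [h, h.not_gt, h.ne']
  · rw [hμ, hμt]
    constructor <;> split_ifs with h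
    · exact sub_nonneg.2 (hπmono h).le
    · exact le_rfl
    · exact sub_nonneg.2 (hπmono h).le
    · exact le_rfl
end
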